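/- Under the standing assumptions, there exists D_0 > 0 such that for every k ∈ ℕ and every M > 0 there exists R = R(k,M) > 0 with the following property: for all g, h ∈ G with ‖g‖_S > R and ‖h‖_S ≤ M, the set π_{[x_0, φ^k x_0]}({g x_0, g h x_0}) has diameter at most D_0. (Crucially, D_0 depends only on G, S, X, x_0, φ and is independent of k and M.) -/

import Mathlib

namespace AcylCount

/-! ### Geodesic segments and Gromov hyperbolicity -/

/-- A finite geodesic segment in a metric space, parametrized by arclength on `[0, len]`,
oriented from `initial := toFun 0` to `terminal := toFun len`. -/
structure GeodesicSegment (X : Type*) [MetricSpace X] where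
  len : ℝ
  len_nonneg : 0 ≤ len
  toFun : ℝ → X
  isom : ∀ s ∈ Set.Icc (0:ℝ) len, ∀ t ∈ Set.Icc (0:ℝ) len,
    dist (toFun s) (toFun t) = |s - t|

namespace GeodesicSegment

variable {X : Type*} [MetricSpace X]

/-- The initial point of a geodesic segment. -/
def initial (γ : GeodesicSegment X) : X := γ.toFun 0

/-- The terminal point of a geodesic segment. -/
def terminal (γ : GeodesicSegment X) : X := γ.toFun γ.len

/-- The image (underlying set) of a geodesic segment. -/
def seg (γ : GeodesicSegment X) : Set X := γ.toFun '' Set.Icc 0 γ.len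

/-- The translate of a geodesic segment by an isometry. -/
def translate (γ : GeodesicSegment X) (f : X → X) (hf : Isometry f) :
    GeodesicSegment X where
  len := γ.len
  len_nonneg := γ.len_nonneg
  toFun := f ∘ γ.toFun
  isom := fun s hs t ht => by
    simp only [Function.comp_apply, hf.dist_eq]
    exact γ.isom s hs t ht

/-- The degenerate geodesic segment consisting of a single point. -/
def point (p : X) : GeodesicSegment X where
  len := 0
  len_nonneg := le_refl 0
  toFun := fun _ => p
  isom := fun s hs t ht => by
    have hs0 : s = 0 := le_antisymm hs.2 hs.1
    have ht0 : t = 0 := le_antisymm ht.2 ht.1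
    simp [hs0, ht0]

/-- `η` is a subsegment of `γ`. -/
def IsSubsegment (η γ : GeodesicSegment X) : Prop :=
  ∃ a b : ℝ, 0 ≤ a ∧ a ≤ b ∧ b ≤ γ.len ∧ η.len = b - a ∧
    ∀ t ∈ Set.Icc (0:ℝ) η.len, η.toFun t = γ.toFun (a + t)

/-- `p` occurs (weakly) before `q` along the oriented geodesic segment `γ`. -/
def Before (γ : GeodesicSegment X) (p q : X) : Prop :=
  ∃ s t : ℝ, s ∈ Set.Icc (0:ℝ) γ.len ∧ t ∈ Set.Icc (0:ℝ) γ.len ∧ s ≤ t ∧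
    γ.toFun s = p ∧ γ.toFun t = q

end GeodesicSegment

/-- A geodesic metric space: every two points are joined by a geodesic segment. -/
def IsGeodesicSpace (X : Type*) [MetricSpace X] : Prop :=
  ∀ x y : X, ∃ γ : GeodesicSegment X, γ.initial = x ∧ γ.terminal = y

/-- δ-hyperbolicity via slim triangles: each side of a geodesic triangle lies in the
closed δ-neighborhood of the union of the other two sides. -/
def IsDeltaHyperbolic (X : Type*) [MetricSpace X] (δ : ℝ) : Prop :=
  ∀ γ₁ γ₂ γ₃ : GeodesicSegment X,
    γ₁.initial = γ₃.initial → γ₁.terminal = γ₂.initial → γ₂.terminal = γ₃.terminal →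
    γ₃.seg ⊆ Metric.cthickening δ (γ₁.seg ∪ γ₂.seg)

variable {X : Type*} [MetricSpace X]

/-- The closest point projection of `x` to (the image of) the geodesic `γ`. -/
def proj (γ : GeodesicSegment X) (x : X) : Set X :=
  {p | p ∈ γ.seg ∧ dist x p = Metric.infDist x γ.seg}

/-- The closest point projection of a set `A` to the geodesic `γ`. -/
def projSet (γ : GeodesicSegment X) (A : Set X) : Set X :=
  ⋃ a ∈ A, proj γ a

/-- The ordered pair of oriented geodesic segments `(γ, η)` is `K`-aligned. -/
def AlignedPair (K : ℝ) (γ η : GeodesicSegment X) : Prop :=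
  Metric.diam (projSet γ η.seg ∪ {γ.terminal}) < K ∧
  Metric.diam (projSet η γ.seg ∪ {η.initial}) < K

/-- A sequence of oriented geodesic segments is `K`-aligned if each consecutive
pair is `K`-aligned. -/
def AlignedSeq (K : ℝ) (l : List (GeodesicSegment X)) : Prop :=
  l.Chain' (AlignedPair K)

/-- The Gromov product `(y, z)_x`. -/
noncomputable def gromovProd (x y z : X) : ℝ := (dist y x + dist x z - dist y z) / 2

/-! ### Word metric -/

variable {G : Type*} [Group G]

/-- The word length of `g` with respect to the (symmetrized) generating set `S`. -/
noncomputable def wordLength (S : Finset G) (g : G) : ℕ :=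
  sInf {n | ∃ l : List G, l.length = n ∧ (∀ x ∈ l, x ∈ S ∨ x⁻¹ ∈ S) ∧ l.prod = g}

/-- The word metric on `G` with respect to `S`. -/
noncomputable def wordDist (S : Finset G) (g h : G) : ℕ := wordLength S (g⁻¹ * h)

/-- The ball of radius `r` in the word metric, centered at the identity. -/
def ball (S : Finset G) (r : ℝ) : Set G := {g | (wordLength S g : ℝ) ≤ r}

/-- `G` has no cyclic subgroup of finite index. -/
def NonVirtuallyCyclic (G : Type*) [Group G] : Prop :=
  ¬ ∃ H : Subgroup G, H.FiniteIndex ∧ IsCyclic H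

/-! ### Isometric actions, loxodromics, WPD -/

/-- `g` is a loxodromic isometry for the action `ρ` with basepoint `x0`: the asymptotic
translation length `τ_X(g) = lim dist x0 (g^n x0) / n` exists and is positive. -/
def IsLoxodromic (ρ : G → X → X) (x0 : X) (g : G) : Prop :=
  ∃ τ : ℝ, 0 < τ ∧
    Filter.Tendsto (fun n : ℕ => dist x0 (ρ (g ^ n) x0) / n) Filter.atTop (nhds τ)

/-- The WPD (weak proper discontinuity) property of `g` for the action `ρ` with
basepoint `x0`. -/
def HasWPD (ρ : G → X → X) (x0 : X) (g : G) : Prop :=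
  ∀ K : ℝ, 0 < K → ∃ N M : ℕ,
    {h : G | dist x0 (ρ h x0) < K ∧ dist (ρ (g ^ N) x0) (ρ h (ρ (g ^ N) x0)) < K}.Finite ∧
    {h : G | dist x0 (ρ h x0) < K ∧ dist (ρ (g ^ N) x0) (ρ h (ρ (g ^ N) x0)) < K}.ncard < M

/-- The list of translated geodesics `h 1 • Υ, …, h m • Υ`. -/
def transList (ρ : G → X → X) (hisom : ∀ g : G, Isometry (ρ g))
    (Υ : GeodesicSegment X) (h : ℕ → G) (m : ℕ) : List (GeodesicSegment X) :=
  (List.range m).map fun i => Υ.translate (ρ (h (i + 1))) (hisom _)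

/-- The specification of the constant `E₀` from Fact 2.7 (Bestvina–Fujiwara):
(i) Gromov product bounds, (ii) the WPD-type conclusion for large projections. -/
def E0Spec (S : Finset G) (ρ : G → X → X) (x0 : X) (φ : G) (E0 : ℝ) : Prop :=
  0 < E0 ∧
  (∀ g : G, ∃ s t : G, (s ∈ S ∨ s = 1) ∧ (t ∈ S ∨ t = 1) ∧
    (∀ i : ℤ, 0 < i → gromovProd x0 (ρ (φ ^ i) x0) (ρ (s * g) x0) ≤ E0) ∧
    (∀ j : ℤ, j < 0 → gromovProd x0 (ρ (φ ^ j) x0) (ρ (t * g) x0) ≤ E0)) ∧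
  (∀ n : ℕ, 0 < n → ∀ g : G, ∀ γ : GeodesicSegment X,
    γ.initial = x0 → γ.terminal = ρ (φ ^ n) x0 →
    ∀ p ∈ proj γ (ρ g x0), ∀ q ∈ proj γ (ρ (g * φ ^ n) x0),
      γ.Before p q → E0 < dist p q →
      ∃ i j : ℕ, i ≤ n ∧ j ≤ n ∧ (wordDist S (φ ^ i) (g * φ ^ j) : ℝ) < E0)

/-- The set `V_{L,ε}(n)`. Here `Υ` is the chosen geodesic `Υ_L = [x₀, φ^L x₀]`. -/
def Vset (S : Finset G) (ρ : G → X → X) (hisom : ∀ g : G, Isometry (ρ g)) (x0 : X)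
    (δ E0 : ℝ) (Υ : GeodesicSegment X) (ε : ℝ) (n : ℕ) : Set G :=
  {g | g ∈ ball S (n:ℝ) ∧ ∃ h : ℕ → G,
    AlignedSeq (6 * E0 + 300 * δ)
      ([GeodesicSegment.point x0] ++ transList ρ hisom Υ h ⌈ε * (n:ℝ)⌉₊ ++
        [GeodesicSegment.point (ρ g x0)])}

/-- The set `W_{L,ε}(n)`. Here `Υ` is the chosen geodesic `Υ_L = [x₀, φ^L x₀]`. -/
def Wset (S : Finset G) (ρ : G → X → X) (hisom : ∀ g : G, Isometry (ρ g)) (x0 : X)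
    (δ E0 : ℝ) (Υ : GeodesicSegment X) (ε : ℝ) (n : ℕ) : Set G :=
  {g | g ∈ ball S (n:ℝ) ∧ ∃ h : ℕ → G,
    AlignedSeq (6 * E0 + 360 * δ)
      ([GeodesicSegment.point x0] ++ transList ρ hisom Υ h ⌈ε * (n:ℝ)⌉₊ ++
        [GeodesicSegment.point (ρ g x0)]) ∧
    AlignedPair (6 * E0 + 360 * δ) (GeodesicSegment.point (ρ g⁻¹ x0))
      (Υ.translate (ρ (h 1)) (hisom _)) ∧
    AlignedPair (6 * E0 + 360 * δ) (Υ.translate (ρ (h ⌈ε * (n:ℝ)⌉₊)) (hisom _))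
      (GeodesicSegment.point (ρ (g ^ 2) x0))}

/-- The set `BAD_{L,ε}(n)`. -/
def BADset (S : Finset G) (ρ : G → X → X) (hisom : ∀ g : G, Isometry (ρ g)) (x0 : X)
    (δ E0 : ℝ) (Υ : GeodesicSegment X) (ε : ℝ) (n : ℕ) : Set G :=
  ball S (n:ℝ) \ (ball S ((⌊(0.9:ℝ) * (n:ℝ)⌋₊ : ℕ) : ℝ) ∪ Vset S ρ hisom x0 δ E0 Υ ε n)

/-! ### Paths in the word metric -/

/-- `P` is a `d_S`-path connecting `a` to `b`. -/
noncomputable def IsPathFrom (S : Finset G) (P : List G) (a b : G) : Prop :=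
  P ≠ [] ∧ P.Chain' (fun u v => wordDist S u v = 1) ∧ P.head? = some a ∧ P.getLast? = some b

/-- The distance `d_S(P, g)` from a path `P` to a group element `g`. -/
noncomputable def pathDist (S : Finset G) (P : List G) (g : G) : ℕ :=
  sInf {d | ∃ v ∈ P, d = wordDist S v g}

section Sequence

variable {a : ℕ → ℝ} {c τ : ℝ}

theorem exists_add_le_apply_two_mul (hτ : 0 < τ)
    (hlim : Filter.Tendsto (fun n : ℕ => a n / n) Filter.atTop (nhds τ)) (B : ℝ) :
    ∃ N : ℕ, 0 < N ∧ a N + B ≤ a (2 * N) := by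
  by_contra! hcon
  have hbound : ∀ m : ℕ, a (2 ^ m) ≤ a 1 + m * B := by
    intro m
    induction m with
    | zero => simp
    | succ m ih =>
      have h := hcon (2 ^ m) (by positivity)
      rw [pow_succ']
      push_cast
      linarith
  have h1 : Filter.Tendsto (fun m : ℕ => a (2 ^ m) / ((2 ^ m : ℕ) : ℝ)) Filter.atTop (nhds τ) :=
    hlim.comp (tendsto_pow_atTop_atTop_of_one_lt (by norm_num : 1 < 2))
  have h2 : Filter.Tendsto (fun m : ℕ => a 1 * ((m : ℝ) ^ 0 / (2 : ℝ) ^ m)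
      + B * ((m : ℝ) ^ 1 / (2 : ℝ) ^ m)) Filter.atTop (nhds (a 1 * 0 + B * 0)) :=
    ((tendsto_pow_const_div_const_pow_of_one_lt 0 (by norm_num)).const_mul _).add
      ((tendsto_pow_const_div_const_pow_of_one_lt 1 (by norm_num)).const_mul _)
  have h3 := le_of_tendsto_of_tendsto' h1 h2 fun m => by
    have hp : (0 : ℝ) < 2 ^ m := by positivity
    have : a 1 * ((m : ℝ) ^ 0 / (2 : ℝ) ^ m) + B * ((m : ℝ) ^ 1 / (2 : ℝ) ^ m)
        = (a 1 + m * B) / 2 ^ m := by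
      field_simp
    rw [this]
    push_cast
    exact div_le_div_of_nonneg_right (hbound m) hp.le
  linarith

/-- A subadditive sequence of linear growth which satisfies the four-point inequality of a
hyperbolic space is additive up to a bounded error. -/
theorem exists_add_le_apply_add (hc : 0 ≤ c) (hτ : 0 < τ)
    (hlim : Filter.Tendsto (fun n : ℕ => a n / n) Filter.atTop (nhds τ))
    (h0 : a 0 = 0) (hnonneg : ∀ n, 0 ≤ a n)
    (hsub : ∀ m n, a (m + n) ≤ a m + a n) (hsub' : ∀ m n, a m ≤ a (m + n) + a n)
    (hfour : ∀ i l r, a (i + l) + a (l + r) ≤ max (a i + a r) (a (i + l + r) + a l) + c) :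
    ∃ C : ℝ, 0 ≤ C ∧ ∀ i j, a i + a j ≤ a (i + j) + C := by
  obtain ⟨N, hN, hbig⟩ := exists_add_le_apply_two_mul hτ hlim (2 * c + 1)
  have hlin : ∀ n : ℕ, a n ≤ n * a 1 := by
    intro n
    induction n with
    | zero => simp [h0]
    | succ n ih =>
      have := hsub n 1
      push_cast
      linarith
  have hstep : ∀ n : ℕ, a (n * N) + (c + 1) ≤ a ((n + 1) * N) := by
    intro n
    induction n with
    | zero =>
      have := hsub N N
      rw [← two_mul] at this
      simp only [zero_mul, h0, zero_add, one_mul]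
      linarith
    | succ n ih =>
      have h := hfour (n * N) N N
      rw [show n * N + N = (n + 1) * N by ring, show N + N = 2 * N by ring,
        show (n + 1) * N + N = (n + 1 + 1) * N by ring] at h
      rcases max_cases (a (n * N) + a N) (a ((n + 1 + 1) * N) + a N) with h' | h' <;> linarith
  have hmul : ∀ i j : ℕ, a (i * N) + a (j * N) ≤ a ((i + j) * N) + 2 * a N := by
    intro i j
    have h := hfour (i * N) N (j * N)
    rw [show i * N + N = (i + 1) * N by ring, show N + j * N = (j + 1) * N by ring,
      show (i + 1) * N + j * N = (i + j) * N + N by ring] at h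
    have hi := hstep i
    have hj := hstep j
    have h' := hsub ((i + j) * N) N
    rcases max_cases (a (i * N) + a (j * N)) (a ((i + j) * N + N) + a N) with h'' | h'' <;>
      linarith
  refine ⟨2 * a N + 4 * (N * a 1), by have := hnonneg N; have := hnonneg 1; positivity, ?_⟩
  intro i j
  have hrem : ∀ r, a (r % N) ≤ N * a 1 := fun r =>
    (hlin _).trans (mul_le_mul_of_nonneg_right
      (by exact_mod_cast (Nat.mod_lt r hN).le) (hnonneg 1))
  have hi := hsub (i / N * N) (i % N)
  have hj := hsub (j / N * N) (j % N)
  have hij := hsub' ((i / N + j / N) * N) (i % N + j % N)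
  have hrr := hsub (i % N) (j % N)
  have hdi : i / N * N + i % N = i := Nat.div_add_mod' i N
  have hdj : j / N * N + j % N = j := Nat.div_add_mod' j N
  rw [show (i / N + j / N) * N + (i % N + j % N)
    = (i / N * N + i % N) + (j / N * N + j % N) by ring, hdi, hdj] at hij
  rw [hdi] at hi
  rw [hdj] at hj
  have := hmul (i / N) (j / N)
  have := hrem i
  have := hrem j
  linarith

end Sequence

section Hyperbolic

namespace GeodesicSegment

variable (γ : GeodesicSegment X)

theorem initial_mem_seg : γ.initial ∈ γ.seg :=
  ⟨0, ⟨le_rfl, γ.len_nonneg⟩, rfl⟩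

theorem terminal_mem_seg : γ.terminal ∈ γ.seg :=
  ⟨γ.len, ⟨γ.len_nonneg, le_rfl⟩, rfl⟩

theorem dist_initial_add_dist_terminal {p : X} (hp : p ∈ γ.seg) :
    dist γ.initial p + dist p γ.terminal = dist γ.initial γ.terminal := by
  obtain ⟨t, ht, rfl⟩ := hp
  have h0 : (0 : ℝ) ∈ Set.Icc 0 γ.len := ⟨le_rfl, γ.len_nonneg⟩
  have h1 : γ.len ∈ Set.Icc 0 γ.len := ⟨γ.len_nonneg, le_rfl⟩
  rw [initial, terminal, γ.isom _ h0 _ ht, γ.isom _ ht _ h1, γ.isom _ h0 _ h1,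
    abs_of_nonpos (by linarith [ht.1]), abs_of_nonpos (by linarith [ht.2]),
    abs_of_nonpos (by linarith [γ.len_nonneg])]
  ring

theorem isPreconnected_seg : IsPreconnected γ.seg := by
  refine isPreconnected_Icc.image _ ?_
  have h : LipschitzOnWith 1 γ.toFun (Set.Icc 0 γ.len) :=
    LipschitzOnWith.of_dist_le_mul fun s hs t ht => by
      rw [γ.isom s hs t ht, NNReal.coe_one, one_mul, Real.dist_eq]
  exact h.continuousOn

/-- The point of a geodesic at distance `s` from `p` in the direction of `q`. -/
theorem exists_mem_seg_dist_eq {p q : X} (hp : p ∈ γ.seg) (hq : q ∈ γ.seg) {s : ℝ}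
    (hs : 0 ≤ s) (hsq : s ≤ dist p q) :
    ∃ t ∈ γ.seg, dist p t = s ∧ dist t q = dist p q - s := by
  obtain ⟨u, hu, rfl⟩ := hp
  obtain ⟨v, hv, rfl⟩ := hq
  rw [γ.isom u hu v hv] at hsq ⊢
  rcases le_total u v with huv | huv
  · rw [abs_of_nonpos (by linarith)] at hsq ⊢
    have hw : u + s ∈ Set.Icc 0 γ.len := ⟨by linarith [hu.1], by linarith [hv.2]⟩
    refine ⟨_, ⟨u + s, hw, rfl⟩, ?_, ?_⟩
    · rw [γ.isom _ hu _ hw, abs_of_nonpos (by linarith)]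
      ring
    · rw [γ.isom _ hw _ hv, abs_of_nonpos (by linarith)]
      ring
  · rw [abs_of_nonneg (by linarith)] at hsq ⊢
    have hw : u - s ∈ Set.Icc 0 γ.len := ⟨by linarith [hv.1], by linarith [hu.2]⟩
    refine ⟨_, ⟨u - s, hw, rfl⟩, ?_, ?_⟩
    · rw [γ.isom _ hu _ hw, abs_of_nonneg (by linarith)]
      ring
    · rw [γ.isom _ hw _ hv, abs_of_nonneg (by linarith)]
      ring

end GeodesicSegment

/-- Gromov's four-point inequality with additive constant `c`. -/
def FourPoint (X : Type*) [MetricSpace X] (c : ℝ) : Prop :=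
  ∀ x y z w : X, dist x z + dist y w ≤
    max (dist x y + dist z w) (dist x w + dist y z) + c

theorem IsDeltaHyperbolic.fourPoint {δ : ℝ} (hδ : 0 < δ) (hgeo : IsGeodesicSpace X)
    (hhyp : IsDeltaHyperbolic X δ) : FourPoint X (8 * δ) := by
  have hslim : ∀ γ₁ γ₂ γ₃ : GeodesicSegment X, γ₁.initial = γ₃.initial →
      γ₁.terminal = γ₂.initial → γ₂.terminal = γ₃.terminal →
      γ₃.seg ⊆ Metric.thickening (2 * δ) γ₁.seg ∪ Metric.thickening (2 * δ) γ₂.seg := by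
    intro γ₁ γ₂ γ₃ h1 h2 h3
    rw [← Metric.thickening_union]
    exact (hhyp γ₁ γ₂ γ₃ h1 h2 h3).trans
      (Metric.cthickening_subset_thickening' (by linarith) (by linarith) _)
  intro x y z w
  obtain ⟨xy, rfl, rfl⟩ := hgeo x y
  obtain ⟨yz, hyz, rfl⟩ := hgeo xy.terminal z
  obtain ⟨xz, hxz, hxz'⟩ := hgeo xy.initial yz.terminal
  obtain ⟨xw, hxw, rfl⟩ := hgeo xy.initial w
  obtain ⟨wz, hwz, hwz'⟩ := hgeo xw.terminal yz.terminal
  obtain ⟨m, hm, hmp, hmq⟩ := xz.isPreconnected_seg _ _ Metric.isOpen_thickening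
    Metric.isOpen_thickening (hslim xy yz xz hxz.symm hyz.symm hxz'.symm)
    ⟨_, xz.initial_mem_seg, Metric.self_subset_thickening (by linarith) _
      (hxz ▸ xy.initial_mem_seg)⟩
    ⟨_, xz.terminal_mem_seg, Metric.self_subset_thickening (by linarith) _
      (hxz' ▸ yz.terminal_mem_seg)⟩
  obtain ⟨p, hp, hmp⟩ := Metric.mem_thickening_iff.1 hmp
  obtain ⟨q, hq, hmq⟩ := Metric.mem_thickening_iff.1 hmq
  have em := xz.dist_initial_add_dist_terminal hm
  have ep := xy.dist_initial_add_dist_terminal hp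
  have eq := yz.dist_initial_add_dist_terminal hq
  rw [hxz, hxz'] at em
  rw [hyz] at eq
  rcases hslim xw wz xz (hxw.trans hxz.symm) hwz.symm (hwz'.trans hxz'.symm) hm with hu | hu
  · obtain ⟨u, hu, hmu⟩ := Metric.mem_thickening_iff.1 hu
    have eu := xw.dist_initial_add_dist_terminal hu
    rw [hxw] at eu
    have t1 := dist_triangle4 xy.terminal q m xw.terminal
    have t2 := dist_triangle m u xw.terminal
    have t3 := dist_triangle xy.initial u m
    have t4 := dist_triangle m q yz.terminal
    rw [dist_comm q m] at t1
    rw [dist_comm u m] at t3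
    linarith [le_max_right (dist xy.initial xy.terminal + dist yz.terminal xw.terminal)
      (dist xy.initial xw.terminal + dist xy.terminal yz.terminal)]
  · obtain ⟨u, hu, hmu⟩ := Metric.mem_thickening_iff.1 hu
    have eu := wz.dist_initial_add_dist_terminal hu
    rw [hwz, hwz'] at eu
    have t1 := dist_triangle4 xy.terminal p m xw.terminal
    have t2 := dist_triangle m u xw.terminal
    have t3 := dist_triangle m u yz.terminal
    have t4 := dist_triangle xy.initial p m
    rw [dist_comm p m, dist_comm xy.terminal p] at t1
    rw [dist_comm p m] at t4
    rw [dist_comm u xw.terminal] at t2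
    rw [dist_comm xw.terminal yz.terminal] at eu
    linarith [le_max_left (dist xy.initial xy.terminal + dist yz.terminal xw.terminal)
      (dist xy.initial xw.terminal + dist xy.terminal yz.terminal)]

/-- Two points that almost lie on a geodesic from `y` to `z`, at almost the same distance
from `y`, are close to each other. -/
theorem FourPoint.dist_le {c : ℝ} (hX : FourPoint X c) {y z w w' : X} {C e : ℝ}
    (hw : dist y w + dist w z ≤ dist y z + C) (hw' : dist y w' + dist w' z ≤ dist y z + C)
    (he : |dist y w - dist y w'| ≤ e) : dist w w' ≤ C + e + c := by
  have h := hX y w z w'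
  rw [dist_comm z w'] at h
  have he' := abs_le.1 he
  rcases max_cases (dist y w + dist w' z) (dist y w' + dist w z) with h' | h' <;> linarith

theorem FourPoint.dist_add_dist_proj_le {c : ℝ} (hc : 0 < c) (hX : FourPoint X c)
    {γ : GeodesicSegment X} {y p r : X} (hp : p ∈ proj γ y) (hr : r ∈ γ.seg) :
    dist y p + dist p r ≤ dist y r + 3 * c := by
  have hmin : ∀ t ∈ γ.seg, dist y p ≤ dist y t := fun t ht => by
    rw [hp.2]
    exact Metric.infDist_le_dist_of_mem ht
  rcases le_total (dist p r) (2 * c) with hpr | hpr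
  · linarith [hmin r hr]
  · obtain ⟨t, ht, hpt, htr⟩ := γ.exists_mem_seg_dist_eq hp.1 hr (by linarith) hpr
    have h := hX y p t r
    have := hmin t ht
    rcases max_cases (dist y p + dist t r) (dist y r + dist p t) with h' | h' <;> linarith

theorem FourPoint.dist_add_dist_proj_add_dist_le {c : ℝ} (hc : 0 < c) (hX : FourPoint X c)
    {γ : GeodesicSegment X} {y z p q : X} (hp : p ∈ proj γ y) (hq : q ∈ proj γ z)
    (hpq : 4 * c < dist p q) :
    dist y p + dist p q + dist q z ≤ dist y z + 7 * c := by
  have h1 := hX.dist_add_dist_proj_le hc hp hq.1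
  have h2 := hX.dist_add_dist_proj_le hc hq hp.1
  have h := hX y p q z
  rw [dist_comm z q, dist_comm q p, dist_comm z p] at h2
  rcases max_cases (dist y p + dist q z) (dist y z + dist p q) with h' | h' <;> linarith

end Hyperbolic

section WordLength

theorem exists_list_length_eq_wordLength {S : Finset G}
    (hS : Subgroup.closure (S : Set G) = ⊤) (g : G) :
    ∃ l : List G, l.length = wordLength S g ∧ (∀ x ∈ l, x ∈ S ∨ x⁻¹ ∈ S) ∧ l.prod = g := by
  have hne : {n | ∃ l : List G, l.length = n ∧ (∀ x ∈ l, x ∈ S ∨ x⁻¹ ∈ S) ∧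
      l.prod = g}.Nonempty := by
    have hg : g ∈ Submonoid.closure ((S : Set G) ∪ (S : Set G)⁻¹) := by
      rw [← Subgroup.closure_toSubmonoid, hS]
      exact Subgroup.mem_top g
    obtain ⟨l, hl, hlg⟩ := Submonoid.exists_list_of_mem_closure hg
    exact ⟨l.length, l, rfl, fun x hx => by simpa using hl x hx, hlg⟩
  exact Nat.sInf_mem hne

theorem finite_ball {S : Finset G} (hS : Subgroup.closure (S : Set G) = ⊤) (r : ℝ) :
    (ball S r).Finite := by
  have hT : {x : G | x ∈ S ∨ x⁻¹ ∈ S}.Finite :=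
    S.finite_toSet.union (S.finite_toSet.preimage inv_injective.injOn)
  have : Finite {x : G | x ∈ S ∨ x⁻¹ ∈ S} := hT
  refine ((List.finite_length_le {x : G | x ∈ S ∨ x⁻¹ ∈ S} ⌊r⌋₊).image
    fun l => (l.map Subtype.val).prod).subset ?_
  intro g hg
  obtain ⟨l, hlen, hl, hlg⟩ := exists_list_length_eq_wordLength hS g
  refine ⟨l.attach.map fun x => ⟨x.1, hl x.1 x.2⟩, ?_, ?_⟩
  · simpa [hlen] using Nat.le_floor hg
  · simpa [List.map_map, Function.comp_def] using hlg

end WordLength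

section Action

variable {ρ : G → X → X}

theorem dist_orbit_pow (hisom : ∀ g : G, Isometry (ρ g))
    (hmul : ∀ g h : G, ∀ x : X, ρ (g * h) x = ρ g (ρ h x)) (x : X) (φ : G) (i n : ℕ) :
    dist (ρ (φ ^ i) x) (ρ (φ ^ (i + n)) x) = dist x (ρ (φ ^ n) x) := by
  rw [pow_add, hmul, (hisom _).dist_eq]

/-- The orbit of a loxodromic isometry follows geodesics. -/
theorem IsLoxodromic.exists_dist_add_dist_le {c : ℝ} (hc : 0 < c) (hX : FourPoint X c)
    (hisom : ∀ g : G, Isometry (ρ g))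
    (hmul : ∀ g h : G, ∀ x : X, ρ (g * h) x = ρ g (ρ h x)) (hone : ∀ x : X, ρ 1 x = x)
    {x0 : X} {φ : G} (hlox : IsLoxodromic ρ x0 φ) :
    ∃ C : ℝ, 0 ≤ C ∧ ∀ i j : ℕ,
      dist x0 (ρ (φ ^ i) x0) + dist (ρ (φ ^ i) x0) (ρ (φ ^ (i + j)) x0) ≤
        dist x0 (ρ (φ ^ (i + j)) x0) + C := by
  obtain ⟨τ, hτ, hlim⟩ := hlox
  have hd := dist_orbit_pow hisom hmul x0 φ
  simp only [hd]
  refine exists_add_le_apply_add (a := fun n => dist x0 (ρ (φ ^ n) x0)) hc.le hτ hlim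
    (by simp [hone]) (fun n => dist_nonneg) (fun m n => ?_) (fun m n => ?_) fun i l r => ?_
  · simpa only [hd] using dist_triangle x0 (ρ (φ ^ m) x0) (ρ (φ ^ (m + n)) x0)
  · have h := dist_triangle_right x0 (ρ (φ ^ m) x0) (ρ (φ ^ (m + n)) x0)
    simpa only [hd] using h
  · have h := hX x0 (ρ (φ ^ i) x0) (ρ (φ ^ (i + l)) x0) (ρ (φ ^ (i + l + r)) x0)
    rw [hd (i + l) r, hd i l, add_assoc i l r, hd i (l + r)] at h
    simpa only [add_assoc] using h

/-- Every point of a geodesic from `x0` to `φ ^ k x0` is close to an orbit point. -/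
theorem exists_dist_orbit_le {c C : ℝ} (hX : FourPoint X c)
    (hisom : ∀ g : G, Isometry (ρ g))
    (hmul : ∀ g h : G, ∀ x : X, ρ (g * h) x = ρ g (ρ h x)) (hone : ∀ x : X, ρ 1 x = x)
    {x0 : X} {φ : G} (hC : 0 ≤ C)
    (horb : ∀ i j : ℕ,
      dist x0 (ρ (φ ^ i) x0) + dist (ρ (φ ^ i) x0) (ρ (φ ^ (i + j)) x0) ≤
        dist x0 (ρ (φ ^ (i + j)) x0) + C)
    {k : ℕ} {p : X} (hp : dist x0 p + dist p (ρ (φ ^ k) x0) = dist x0 (ρ (φ ^ k) x0)) :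
    ∃ i : ℕ, dist p (ρ (φ ^ i) x0) ≤ C + dist x0 (ρ φ x0) + c := by
  classical
  set P : ℕ → Prop := fun i => dist x0 (ρ (φ ^ i) x0) ≤ dist x0 p with hP
  have hP0 : P 0 := by simp [hP, hone]
  obtain ⟨hik, hPi, hmax⟩ := (Nat.findGreatest_eq_iff (P := P) (k := k)).1 rfl
  set i := Nat.findGreatest P k
  have hPi : P i := by
    by_cases hi : i = 0
    · rw [hi]; exact hP0
    · exact hPi hi
  refine ⟨i, hX.dist_le (by linarith) ?_ ?_ (y := x0) (z := ρ (φ ^ k) x0)⟩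
  · simpa [Nat.add_sub_cancel' hik] using horb i (k - i)
  · rw [abs_of_nonneg (sub_nonneg.2 hPi)]
    rcases hik.eq_or_lt with h | h
    · rw [h]
      have h1 : 0 ≤ dist p (ρ (φ ^ k) x0) := dist_nonneg
      have h2 : 0 ≤ dist x0 (ρ φ x0) := dist_nonneg
      linarith
    · have hlt := hmax (Nat.lt_succ_self i) h
      simp only [hP, not_le] at hlt
      have h1 := dist_triangle x0 (ρ (φ ^ i) x0) (ρ (φ ^ (i + 1)) x0)
      rw [dist_orbit_pow hisom hmul, pow_one] at h1
      simp only [Nat.succ_eq_add_one] at hlt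
      linarith

/-- Only finitely many group elements almost fix two points that are far apart on a geodesic
between points of the orbit of a loxodromic WPD element. -/
theorem HasWPD.exists_finite {c : ℝ} (hc : 0 < c) (hX : FourPoint X c)
    (hisom : ∀ g : G, Isometry (ρ g))
    (hmul : ∀ g h : G, ∀ x : X, ρ (g * h) x = ρ g (ρ h x)) (hone : ∀ x : X, ρ 1 x = x)
    {x0 : X} {φ : G} (hlox : IsLoxodromic ρ x0 φ) (hwpd : HasWPD ρ x0 φ) {E : ℝ}
    (hE : 0 ≤ E) :
    ∃ D : ℝ, ∀ (k : ℕ) (p q : X),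
      dist x0 p + dist p (ρ (φ ^ k) x0) = dist x0 (ρ (φ ^ k) x0) →
      dist x0 q + dist q (ρ (φ ^ k) x0) = dist x0 (ρ (φ ^ k) x0) →
      D < dist p q → {ψ : G | dist p (ρ ψ p) ≤ E ∧ dist q (ρ ψ q) ≤ E}.Finite := by
  obtain ⟨C, hC, horb⟩ := hlox.exists_dist_add_dist_le hc hX hisom hmul hone
  set E₂ := C + dist x0 (ρ φ x0) + c with hE₂
  have hE₂0 : 0 ≤ E₂ := by positivity
  set E₃ := E + 2 * E₂ with hE₃
  obtain ⟨N, -, hfin, -⟩ := hwpd (C + 3 * E₃ + c + 1) (by positivity)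
  have hlin : ∀ n : ℕ, dist x0 (ρ (φ ^ n) x0) ≤ n * dist x0 (ρ φ x0) := by
    intro n
    induction n with
    | zero => simp [hone]
    | succ n ih =>
      have h := dist_triangle x0 (ρ (φ ^ n) x0) (ρ (φ ^ (n + 1)) x0)
      rw [dist_orbit_pow hisom hmul, pow_one] at h
      push_cast
      linarith
  have hmove : ∀ (p x : X) (ψ : G), dist p x ≤ E₂ → dist p (ρ ψ p) ≤ E →
      dist x (ρ ψ x) ≤ E₃ := by
    intro p x ψ hpx hψ
    have h := dist_triangle4 x p (ρ ψ p) (ρ ψ x)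
    rw [(hisom ψ).dist_eq, dist_comm x p] at h
    linarith
  refine ⟨2 * E₂ + N * dist x0 (ρ φ x0), fun k p q hp hq hpq => ?_⟩
  obtain ⟨i, hi⟩ := exists_dist_orbit_le hX hisom hmul hone hC horb hp
  obtain ⟨j, hj⟩ := exists_dist_orbit_le hX hisom hmul hone hC horb hq
  wlog hij : i ≤ j generalizing p q i j
  · have := this q p hq hp (by rwa [dist_comm q p]) j hj i hi (le_of_not_ge hij)
    simpa only [and_comm] using this
  obtain ⟨n, rfl⟩ := Nat.exists_eq_add_of_le hij
  have hNn : N ≤ n := by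
    by_contra! hlt
    have h := dist_triangle4 p (ρ (φ ^ i) x0) (ρ (φ ^ (i + n)) x0) q
    rw [dist_orbit_pow hisom hmul, dist_comm (ρ (φ ^ (i + n)) x0) q] at h
    have h1 := hlin n
    have h2 : (n : ℝ) * dist x0 (ρ φ x0) ≤ N * dist x0 (ρ φ x0) :=
      mul_le_mul_of_nonneg_right (by exact_mod_cast hlt.le) dist_nonneg
    linarith
  obtain ⟨m, rfl⟩ := Nat.exists_eq_add_of_le hNn
  refine (hfin.preimage (f := fun ψ => (φ ^ i)⁻¹ * ψ * φ ^ i)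
    (fun a _ b _ hab => by simpa using hab)).subset ?_
  rintro ψ ⟨hψp, hψq⟩
  have hconj : ∀ x : X, ρ (φ ^ i) (ρ ((φ ^ i)⁻¹ * ψ * φ ^ i) x) = ρ ψ (ρ (φ ^ i) x) := by
    intro x
    rw [← hmul, ← hmul]
    congr 1
    group
  set θ := (φ ^ i)⁻¹ * ψ * φ ^ i
  have hθ0 : dist x0 (ρ θ x0) ≤ E₃ := by
    rw [← (hisom (φ ^ i)).dist_eq, hconj]
    exact hmove _ _ _ hi hψp
  have hθn : dist (ρ (φ ^ (N + m)) x0) (ρ θ (ρ (φ ^ (N + m)) x0)) ≤ E₃ := by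
    rw [← (hisom (φ ^ i)).dist_eq, hconj, ← hmul, ← pow_add]
    exact hmove _ _ _ hj hψq
  have hmid := horb N m
  set w := ρ (φ ^ N) x0
  set z := ρ (φ ^ (N + m)) x0
  have h1 := dist_triangle x0 (ρ θ x0) (ρ θ w)
  have h2 := dist_triangle (ρ θ w) (ρ θ z) z
  have h3 := dist_triangle (ρ θ x0) x0 (ρ θ w)
  rw [(hisom θ).dist_eq] at h1 h2 h3
  rw [dist_comm (ρ θ z) z] at h2
  rw [dist_comm (ρ θ x0) x0] at h3
  have hE₃0 : 0 ≤ E₃ := by positivity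
  have hw := hX.dist_le (y := x0) (z := z) (w := w) (w' := ρ θ w) (C := C + 2 * E₃) (e := E₃)
    (by linarith) (by linarith) (by rw [abs_le]; constructor <;> linarith)
  exact ⟨by linarith, by linarith⟩

theorem abs_sub_le_one_of_floor_eq {a b : ℝ} {n : ℕ} (ha : 0 ≤ a) (hb : 0 ≤ b)
    (han : ⌊a⌋₊ = n) (hbn : ⌊b⌋₊ = n) : |a - b| ≤ 1 := by
  have h1 := (Nat.floor_eq_iff ha).1 han
  have h2 := (Nat.floor_eq_iff hb).1 hbn
  rw [abs_le]
  constructor <;> linarith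

/-- `p` lies on a geodesic from `x` to `z` and almost on a geodesic from `y` to `y'`, and its
distances to `x` and `y` are known up to an error `1`. -/
structure IsTracked (C : ℝ) (x z y y' : X) (m n : ℕ) (p : X) : Prop where
  between : dist x p + dist p z = dist x z
  almost_between : dist y p + dist p y' ≤ dist y y' + C
  floor_dist_left : ⌊dist x p⌋₊ = m
  floor_dist_right : ⌊dist y p⌋₊ = n

theorem IsTracked.dist_map_le {c C : ℝ} (hX : FourPoint X c) {x z y y' p p' : X} {m n : ℕ}
    {f : X → X} (hf : Isometry f) (hp : IsTracked C x z y y' m n p)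
    (hp' : IsTracked C x z (f y) (f y') m n p') : dist p (f p) ≤ C + 2 * c + 2 := by
  have h1 : dist p p' ≤ 0 + 1 + c := hX.dist_le (y := x) (z := z) (by linarith [hp.between])
    (by linarith [hp'.between])
    (abs_sub_le_one_of_floor_eq dist_nonneg dist_nonneg hp.floor_dist_left hp'.floor_dist_left)
  have h2 : dist p' (f p) ≤ C + 1 + c := by
    refine hX.dist_le hp'.almost_between ?_ ?_
    · simpa only [hf.dist_eq] using hp.almost_between
    · rw [hf.dist_eq]
      exact abs_sub_le_one_of_floor_eq dist_nonneg dist_nonneg hp'.floor_dist_right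
        hp.floor_dist_right
  linarith [dist_triangle p p' (f p)]

/-- Only finitely many translates of the pair `(u, u')` track a prescribed pair of far apart
points, provided that few group elements almost fix both of them. -/
theorem finite_setOf_isTracked {c C D : ℝ} (hX : FourPoint X c)
    (hisom : ∀ g : G, Isometry (ρ g))
    (hmul : ∀ g h : G, ∀ x : X, ρ (g * h) x = ρ g (ρ h x)) {x z : X}
    (hfin : ∀ p q : X, dist x p + dist p z = dist x z → dist x q + dist q z = dist x z →
      D < dist p q →
      {ψ : G | dist p (ρ ψ p) ≤ C + 2 * c + 2 ∧ dist q (ρ ψ q) ≤ C + 2 * c + 2}.Finite)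
    (u u' : X) (m₁ n₁ m₂ n₂ : ℕ) :
    {g : G | ∃ p q, D < dist p q ∧ IsTracked C x z (ρ g u) (ρ g u') m₁ n₁ p ∧
      IsTracked C x z (ρ g u) (ρ g u') m₂ n₂ q}.Finite := by
  rcases Set.eq_empty_or_nonempty {g : G | ∃ p q, D < dist p q ∧
    IsTracked C x z (ρ g u) (ρ g u') m₁ n₁ p ∧
      IsTracked C x z (ρ g u) (ρ g u') m₂ n₂ q} with h | ⟨g₀, p, q, hpq, hp, hq⟩
  · rw [h]
    exact Set.finite_empty
  · refine ((hfin p q hp.between hq.between hpq).image fun ψ => ψ * g₀).subset ?_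
    rintro g ⟨p', q', -, hp', hq'⟩
    have hg : ∀ v, ρ g v = ρ (g * g₀⁻¹) (ρ g₀ v) := fun v => by
      rw [← hmul, inv_mul_cancel_right]
    rw [hg u, hg u'] at hp' hq'
    exact ⟨g * g₀⁻¹, ⟨hp.dist_map_le hX (hisom _) hp', hq.dist_map_le hX (hisom _) hq'⟩,
      inv_mul_cancel_right g g₀⟩

end Action

/-- Lemma 3.2: a uniform bound `D₀` (independent of `k` and `M`) on the diameter of the
projection of `{g x₀, g h x₀}` onto `[x₀, φ^k x₀]`, once `‖g‖_S` is large enough. -/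
theorem amplify_wpd {G : Type*} [Group G] {X : Type*} [MetricSpace X]
    (S : Finset G) (hSgen : Subgroup.closure (S : Set G) = ⊤)
    (hNVC : NonVirtuallyCyclic G)
    (δ : ℝ) (hδ : 0 < δ) (hgeo : IsGeodesicSpace X) (hhyp : IsDeltaHyperbolic X δ)
    (ρ : G → X → X) (hisom : ∀ g : G, Isometry (ρ g))
    (hmul : ∀ g h : G, ∀ x : X, ρ (g * h) x = ρ g (ρ h x)) (hone : ∀ x : X, ρ 1 x = x)
    (x0 : X) (φ : G)
    (hlox : IsLoxodromic ρ x0 φ) (hwpd : HasWPD ρ x0 φ) :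
    ∃ D0 : ℝ, 0 < D0 ∧ ∀ (k : ℕ) (M : ℝ), 0 < M → ∃ R : ℝ, 0 < R ∧
      ∀ g h : G, R < (wordLength S g : ℝ) → (wordLength S h : ℝ) ≤ M →
        ∀ γ : GeodesicSegment X, γ.initial = x0 → γ.terminal = ρ (φ ^ k) x0 →
          Metric.diam (proj γ (ρ g x0) ∪ proj γ (ρ (g * h) x0)) ≤ D0 := by
  have hX := hhyp.fourPoint hδ hgeo
  set c := 8 * δ
  have hc : 0 < c := by positivity
  obtain ⟨D, hD⟩ := hwpd.exists_finite hc hX hisom hmul hone hlox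
    (E := 7 * c + 2 * c + 2) (by positivity)
  set D0 := max D (4 * c)
  have hD0 : 0 < D0 := lt_max_of_lt_right (by positivity)
  refine ⟨D0, hD0, fun k M hM => ?_⟩
  set z := ρ (φ ^ k) x0
  have hfin := (finite_ball hSgen M).biUnion fun h₁ _ =>
    (finite_ball hSgen M).biUnion fun h₂ _ =>
    (Set.finite_Iic ⌊dist x0 z⌋₊).biUnion fun m₁ _ =>
    (Set.finite_Iic ⌊dist x0 z⌋₊).biUnion fun m₂ _ =>
    (Set.finite_Iic ⌊dist (ρ h₁ x0) (ρ h₂ x0) + 7 * c⌋₊).biUnion fun n₁ _ =>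
    (Set.finite_Iic ⌊dist (ρ h₁ x0) (ρ h₂ x0) + 7 * c⌋₊).biUnion fun n₂ _ =>
      finite_setOf_isTracked hX hisom hmul (hD k) (ρ h₁ x0) (ρ h₂ x0) m₁ n₁ m₂ n₂
  obtain ⟨R, hR⟩ := (hfin.image (wordLength S)).bddAbove
  refine ⟨R + 1, by positivity, fun g h hg hh γ hγ hγ' => ?_⟩
  have key : ∀ h₁ ∈ ball S M, ∀ h₂ ∈ ball S M, ∀ p ∈ proj γ (ρ (g * h₁) x0),
      ∀ q ∈ proj γ (ρ (g * h₂) x0), dist p q ≤ D0 := by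
    intro h₁ hh₁ h₂ hh₂ p hp q hq
    by_contra! hpq
    have hsum := hX.dist_add_dist_proj_add_dist_le hc hp hq
      (lt_of_le_of_lt (le_max_right _ _) hpq)
    have hp' := γ.dist_initial_add_dist_terminal hp.1
    have hq' := γ.dist_initial_add_dist_terminal hq.1
    rw [hγ, hγ'] at hp' hq'
    simp only [hmul] at hsum
    have t1 := dist_triangle p q (ρ g (ρ h₂ x0))
    have t2 := dist_triangle (ρ g (ρ h₁ x0)) p q
    have t3 : dist (ρ g (ρ h₁ x0)) (ρ g (ρ h₂ x0)) = dist (ρ h₁ x0) (ρ h₂ x0) :=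
      (hisom g).dist_eq _ _
    have t4 : 0 ≤ dist p z := dist_nonneg
    have t5 : 0 ≤ dist q z := dist_nonneg
    have t6 : 0 ≤ dist p q := dist_nonneg
    have t7 : 0 ≤ dist q (ρ g (ρ h₂ x0)) := dist_nonneg
    have hmem := hR (Set.mem_image_of_mem (wordLength S) (Set.mem_biUnion hh₁ <|
      Set.mem_biUnion hh₂ <|
      Set.mem_biUnion (Set.mem_Iic.2 <| Nat.floor_mono (by linarith : dist x0 p ≤ dist x0 z)) <|
      Set.mem_biUnion (Set.mem_Iic.2 <| Nat.floor_mono (by linarith : dist x0 q ≤ dist x0 z)) <|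
      Set.mem_biUnion (Set.mem_Iic.2 <| Nat.floor_mono (by linarith :
        dist (ρ g (ρ h₁ x0)) p ≤ dist (ρ h₁ x0) (ρ h₂ x0) + 7 * c)) <|
      Set.mem_biUnion (Set.mem_Iic.2 <| Nat.floor_mono (by linarith :
        dist (ρ g (ρ h₁ x0)) q ≤ dist (ρ h₁ x0) (ρ h₂ x0) + 7 * c))
      ⟨p, q, lt_of_le_of_lt (le_max_left _ _) hpq, ⟨hp', by linarith, rfl, rfl⟩,
        ⟨hq', by linarith, rfl, rfl⟩⟩))
    have : (wordLength S g : ℝ) ≤ R := by exact_mod_cast hmem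
    linarith
  have h1 : (1 : G) ∈ ball S M := by
    have : wordLength S (1 : G) ≤ 0 := Nat.sInf_le ⟨[], rfl, by simp, rfl⟩
    simpa [ball, Nat.le_zero.1 this] using hM.le
  have hunion : ∀ p ∈ proj γ (ρ g x0) ∪ proj γ (ρ (g * h) x0),
      ∃ h' ∈ ball S M, p ∈ proj γ (ρ (g * h') x0) := by
    rintro p (hp | hp)
    · exact ⟨1, h1, by rwa [mul_one]⟩
    · exact ⟨h, hh, hp⟩
  refine Metric.diam_le_of_forall_dist_le hD0.le fun p hp q hq => ?_
  obtain ⟨h₁, hh₁, hp⟩ := hunion p hp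
  obtain ⟨h₂, hh₂, hq⟩ := hunion q hq
  exact key h₁ hh₁ h₂ hh₂ p hp q hq

end AcylCount
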